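/- Let r > 0, V a j-dimensional linear subspace of ℝⁿ, and e_1, …, e_{n−j} an orthonormal basis of V^⊥. Let f be Lipschitz on B(0,r) with |d_V f| ≤ 1 and |∂_{e_ι} f| ≤ 1 a.e. for every ι. Then for every α₁, α₂ ∈ (0,1) there exists a function u ∈ C^∞(B(0,r)) ∩ C(closure of B(0,r)) such that: u = f on ∂B(0,r); ‖f − u‖_∞ ≤ (α₁α₂/18) r; |d_V u| ≤ 1 + α₁ and |∂_{e_ι} u| ≤ 1 + α₁ on B(0,r) for every ι; and u = f ∗ ρ_η on B(0, (1 − α₂/2)r) with η := α₁α₂ r / (18√(n−j+1)). -/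

import Mathlib

open MeasureTheory Metric Set

/-- Mollification of `f` at scale `η` with kernel `ρ`:
`(f ∗ ρ_η)(x) = ∫ f(x − y) η^{-n} ρ(y/η) dy`. -/
noncomputable def mollify (n : ℕ) (f ρ : EuclideanSpace ℝ (Fin n) → ℝ) (η : ℝ)
    (x : EuclideanSpace ℝ (Fin n)) : ℝ :=
  ∫ y, f (x - y) * ((η ^ n)⁻¹ * ρ (η⁻¹ • y))

theorem LipschitzWith.abs_sub_le_of_ae_abs_fderiv_apply_le {E : Type*} [NormedAddCommGroup E]
    [NormedSpace ℝ E] [FiniteDimensional ℝ E] [MeasurableSpace E] [BorelSpace E]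
    (μ : Measure E) [μ.IsAddHaarMeasure] {F : E → ℝ} {L : NNReal} (hF : LipschitzWith L F)
    {U : Set E} (hU : IsOpen U) (hUc : Convex ℝ U) {w : E} {C : ℝ}
    (h : ∀ᵐ x ∂μ, x ∈ U → DifferentiableAt ℝ F x ∧ |fderiv ℝ F x w| ≤ C)
    {y : E} (hy : y ∈ U) (hyw : y + w ∈ U) : |F (y + w) - F y| ≤ C := by
  have hseg : ∀ t ∈ Icc (0 : ℝ) 1, y + t • w ∈ U := fun t ht => by
    simpa using hUc.add_smul_sub_mem hy hyw ht
  obtain ⟨δ₀, hδ₀, hδU⟩ : ∃ δ > 0, cthickening δ (segment ℝ y (y + w)) ⊆ U := by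
    refine IsCompact.exists_cthickening_subset_open ?_ hU (hUc.segment_subset hy hyw)
    rw [segment_eq_image]
    exact isCompact_Icc.image (by fun_prop)
  have hball : ∀ t ∈ Icc (0 : ℝ) 1, ∀ a ∈ closedBall (0 : E) δ₀, y + t • w + a ∈ U := by
    intro t ht a ha
    refine hδU (closedBall_subset_cthickening (x := y + t • w) ?_ _ ?_)
    · rw [segment_eq_image']
      exact ⟨t, ht, by simp⟩
    · simpa [dist_eq_norm] using ha
  have key : ∀ δ ∈ Ioc 0 δ₀, |F (y + w) - F y| ≤ C + 2 * L * δ := by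
    intro δ hδ
    set K := closedBall (0 : E) δ
    set G : ℝ → ℝ := fun t => ∫ a in K, F (y + t • w + a) ∂μ with hG
    have hK : IsCompact K := isCompact_closedBall _ _
    have hKfin : μ K < ⊤ := hK.measure_lt_top
    have : IsFiniteMeasure (μ.restrict K) := ⟨by simpa using hKfin⟩
    have hpos : 0 < μ.real K :=
      ENNReal.toReal_pos (measure_closedBall_pos μ _ hδ.1).ne' hKfin.ne
    have hcont : ∀ c : E, Continuous fun a => F (c + a) := fun c =>
      hF.continuous.comp (by fun_prop)
    have hint : ∀ c : E, Integrable (fun a => F (c + a)) (μ.restrict K) := fun c =>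
      (hcont c).continuousOn.integrableOn_compact hK
    have hder : ∀ t ∈ Icc (0 : ℝ) 1, HasDerivAt G
        (∫ a in K, fderiv ℝ F (y + t • w + a) w ∂μ) t ∧
        ‖∫ a in K, fderiv ℝ F (y + t • w + a) w ∂μ‖ ≤ C * μ.real K := by
      intro t ht
      have hae : ∀ᵐ a ∂μ, a ∈ K → DifferentiableAt ℝ F (y + t • w + a) ∧
          |fderiv ℝ F (y + t • w + a) w| ≤ C := by
        filter_upwards [(measurePreserving_add_left μ (y + t • w)).quasiMeasurePreserving.ae h]
          with a ha haK
        exact ha (hball t ht a (closedBall_subset_closedBall hδ.2 haK))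
      refine ⟨?_, norm_setIntegral_le_of_norm_le_const_ae' hKfin (hae.mono fun a ha haK => ?_)⟩
      · refine (hasDerivAt_integral_of_dominated_loc_of_lip (s := univ) Filter.univ_mem
          (bound := fun _ => L * ‖w‖) (Filter.Eventually.of_forall fun t' =>
            (hcont _).aestronglyMeasurable) (hint _) ?_ ?_ (integrable_const _) ?_).2
        · exact ((measurable_fderiv_apply_const ℝ F w).comp
            (measurable_const_add (y + t • w))).aestronglyMeasurable
        · refine Filter.Eventually.of_forall fun a =>
            LipschitzOnWith.of_dist_le_mul fun s _ s' _ => ?_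
          refine (hF.dist_le_mul _ _).trans_eq ?_
          rw [dist_add_right, dist_add_left, dist_eq_norm, ← sub_smul, norm_smul, Real.dist_eq,
            Real.coe_nnabs, abs_of_nonneg (by positivity)]
          simp only [Real.norm_eq_abs]
          ring
        · rw [ae_restrict_iff' measurableSet_closedBall]
          filter_upwards [hae] with a ha haK
          have h1 : HasDerivAt (fun t : ℝ => y + t • w + a) w t := by
            simpa using (((hasDerivAt_id t).smul_const w).const_add y).add_const a
          exact (ha haK).1.hasFDerivAt.comp_hasDerivAt t h1
      · exact (ha haK).2
    have hG01 : |G 1 - G 0| ≤ C * μ.real K :=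
      norm_image_sub_le_of_norm_deriv_le_segment_01'
        (fun t ht => (hder t ht).1.hasDerivWithinAt)
        (fun t ht => (hder t ⟨ht.1, ht.2.le⟩).2)
    have happ : ∀ c : E, |(∫ a in K, F (c + a) ∂μ) - μ.real K * F c| ≤ L * δ * μ.real K := by
      intro c
      have h1 : (∫ a in K, F (c + a) ∂μ) - μ.real K * F c = ∫ a in K, (F (c + a) - F c) ∂μ := by
        rw [integral_sub (hint c) (integrable_const _)]
        simp
      rw [h1, ← Real.norm_eq_abs]
      refine norm_setIntegral_le_of_norm_le_const hKfin fun a ha => ?_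
      have h2 := hF.dist_le_mul (c + a) c
      rw [dist_eq_norm, dist_eq_norm, add_sub_cancel_left] at h2
      exact h2.trans (by gcongr; simpa [K] using ha)
    have h1 := happ (y + w)
    have h0 := happ y
    simp only [hG, one_smul, zero_smul, add_zero] at hG01
    rw [← mul_le_mul_iff_left₀ hpos, ← abs_of_pos hpos, ← abs_mul, abs_of_pos hpos]
    rw [abs_le] at *
    constructor <;> nlinarith
  refine le_of_forall_pos_le_add fun ε hε => ?_
  have hLpos : 0 < 2 * (L : ℝ) + 1 := by positivity
  refine (key (min δ₀ (ε / (2 * L + 1))) ⟨by positivity, min_le_left _ _⟩).trans ?_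
  have h1 : min δ₀ (ε / (2 * L + 1)) * (2 * L + 1) ≤ ε :=
    (le_div_iff₀ hLpos).1 (min_le_right _ _)
  have h2 : 0 < min δ₀ (ε / (2 * L + 1)) := by positivity
  nlinarith

theorem abs_apply_le_sqrt_mul_norm_of_orthonormal {E : Type*} [NormedAddCommGroup E]
    [InnerProductSpace ℝ E] {ι : Type*} [Fintype ι] (V : Submodule ℝ E)
    [V.HasOrthogonalProjection] {e : ι → E} (he : Orthonormal ℝ e)
    (hspan : Submodule.span ℝ (range e) = Vᗮ) (ℓ : E →L[ℝ] ℝ)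
    (hV : ∀ v ∈ V, ‖v‖ ≤ 1 → |ℓ v| ≤ 1) (hℓe : ∀ i, |ℓ (e i)| ≤ 1) (w : E) :
    |ℓ w| ≤ √(Fintype.card ι + 1) * ‖w‖ := by
  obtain ⟨p, hp, q, hq, rfl⟩ := V.exists_add_mem_mem_orthogonal w
  have hpq := norm_add_sq_eq_norm_sq_add_norm_sq_of_inner_eq_zero p q
    (Submodule.inner_right_of_mem_orthogonal hp hq)
  obtain ⟨c, rfl⟩ := (Submodule.mem_span_range_iff_exists_fun ℝ).1 (hspan ▸ hq)
  have hqn : ‖∑ i, c i • e i‖ * ‖∑ i, c i • e i‖ = ∑ i, |c i| ^ 2 := by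
    rw [← real_inner_self_eq_norm_mul_norm, he.inner_sum]
    simp [sq]
  have hℓp : |ℓ p| ≤ ‖p‖ := by
    rcases eq_or_ne p 0 with rfl | h0
    · simp
    · have h1 := hV (‖p‖⁻¹ • p) (V.smul_mem _ hp) (by simp [norm_smul, h0])
      rw [map_smul, smul_eq_mul, abs_mul, abs_inv, abs_norm,
        inv_mul_le_iff₀ (norm_pos_iff.2 h0), mul_one] at h1
      exact h1
  have hℓq : |ℓ (∑ i, c i • e i)| ≤ ∑ i, |c i| := by
    rw [map_sum]
    refine (Finset.abs_sum_le_sum_abs _ _).trans (Finset.sum_le_sum fun i _ => ?_)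
    rw [map_smul, smul_eq_mul, abs_mul]
    exact mul_le_of_le_one_right (abs_nonneg _) (hℓe i)
  have hcs := sq_sum_le_card_mul_sum_sq (s := Finset.univ)
    (f := fun o : Option ι => o.elim ‖p‖ fun i => |c i|)
  simp only [Fintype.sum_option, Option.elim, Finset.card_univ, Fintype.card_option,
    Nat.cast_add, Nat.cast_one] at hcs
  rw [← Real.sqrt_sq (norm_nonneg _), ← Real.sqrt_mul (by positivity)]
  refine Real.le_sqrt_of_sq_le ?_
  calc |ℓ (p + ∑ i, c i • e i)| ^ 2 ≤ (‖p‖ + ∑ i, |c i|) ^ 2 := by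
        gcongr
        rw [map_add]
        exact (abs_add_le _ _).trans (add_le_add hℓp hℓq)
    _ ≤ _ := hcs
    _ = _ := by rw [sq ‖p + _‖, hpq, hqn, sq ‖p‖]

/-- A smooth cutoff that vanishes at `0`, is positive on `(0, ∞)` and equals `1` on `[1, ∞)`. -/
noncomputable def cutoff (t : ℝ) : ℝ := 1 - Real.exp 1 * expNegInvGlue (1 - t)

namespace cutoff

theorem contDiff {m : ℕ∞} : ContDiff ℝ m cutoff := by
  unfold cutoff
  fun_prop

theorem apply_zero : cutoff 0 = 0 := by
  norm_num [cutoff, expNegInvGlue, ← Real.exp_add]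

theorem eq_one_of_one_le {t : ℝ} (ht : 1 ≤ t) : cutoff t = 1 := by
  simp [cutoff, expNegInvGlue.zero_of_nonpos (sub_nonpos.2 ht)]

theorem le_one (t : ℝ) : cutoff t ≤ 1 :=
  sub_le_self _ (mul_nonneg (Real.exp_pos _).le (expNegInvGlue.nonneg _))

theorem pos_of_pos {t : ℝ} (ht : 0 < t) : 0 < cutoff t := by
  rcases le_or_gt 1 t with h | h
  · simp [eq_one_of_one_le h]
  · have h1 : 1 < (1 - t)⁻¹ := (one_lt_inv₀ (by linarith)).2 (by linarith)
    rw [cutoff, expNegInvGlue, if_neg (by linarith), ← Real.exp_add, sub_pos, Real.exp_lt_one_iff]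
    linarith

theorem hasDerivAt (t : ℝ) :
    HasDerivAt cutoff (Real.exp 1 * ((1 - t)⁻¹ ^ 2 * expNegInvGlue (1 - t))) t := by
  have h := expNegInvGlue.hasDerivAt_polynomial_eval_inv_mul 1 (1 - t)
  simp only [Polynomial.eval_one, one_mul, Polynomial.derivative_one, sub_zero, mul_one,
    Polynomial.eval_pow, Polynomial.eval_X] at h
  have h2 := ((h.comp_const_sub 1 t).const_mul (Real.exp 1)).const_sub 1
  rw [mul_neg, neg_neg] at h2
  exact h2

theorem lipschitzWith : LipschitzWith 4 cutoff := by
  refine lipschitzWith_of_nnnorm_deriv_le (fun t => (hasDerivAt t).differentiableAt) fun t => ?_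
  rw [(hasDerivAt t).deriv, ← NNReal.coe_le_coe, coe_nnnorm, Real.norm_of_nonneg
    (mul_nonneg (Real.exp_pos _).le (mul_nonneg (by positivity) (expNegInvGlue.nonneg _)))]
  rcases le_or_gt (1 - t) 0 with h | h
  · simp [expNegInvGlue.zero_of_nonpos h]
  · set w := (1 - t)⁻¹
    have hw : 0 < w := inv_pos.2 h
    rw [expNegInvGlue, if_neg (by linarith), mul_left_comm, ← Real.exp_add]
    have h1 := Real.add_one_le_exp ((w - 1) / 2)
    have h2 : Real.exp ((w - 1) / 2) ^ 2 * Real.exp (1 + -w) = 1 := by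
      rw [← Real.exp_nat_mul, ← Real.exp_add, Real.exp_eq_one_iff]
      push_cast
      ring
    calc w ^ 2 * Real.exp (1 + -w) ≤ (4 * Real.exp ((w - 1) / 2) ^ 2) * Real.exp (1 + -w) := by
          gcongr
          nlinarith
      _ = 4 := by rw [mul_assoc, h2, mul_one]
      _ ≤ _ := le_rfl

end cutoff

section Mollify

variable {n : ℕ} {F ρ : EuclideanSpace ℝ (Fin n) → ℝ}

theorem mollify_eq_integral_sub_smul {s : ℝ} (hs : 0 < s) (x : EuclideanSpace ℝ (Fin n)) :
    mollify n F ρ s x = ∫ z, F (x - s • z) * ρ z := by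
  have h := Measure.integral_comp_inv_smul_of_nonneg (volume : Measure (EuclideanSpace ℝ (Fin n)))
    (fun z => F (x - s • z) * ρ z) hs.le
  simp only [smul_inv_smul₀ hs.ne', finrank_euclideanSpace, Fintype.card_fin, smul_eq_mul] at h
  rw [mollify, eq_inv_mul_iff_mul_eq₀ (pow_pos hs n).ne' |>.2 h.symm, ← integral_const_mul]
  exact integral_congr_ae (.of_forall fun y => by ring)

theorem contDiffOn_mollify (hF : LocallyIntegrable F) (hρ : ContDiff ℝ (⊤ : ℕ∞) ρ)
    (hsupp : Function.support ρ ⊆ closedBall 0 1) :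
    ContDiffOn ℝ (⊤ : ℕ∞)
      (fun q : ℝ × EuclideanSpace ℝ (Fin n) => mollify n F ρ q.1 q.2) (Ioi 0 ×ˢ univ) := by
  have hbdd : ∀ M : ℝ, ContDiffOn ℝ (⊤ : ℕ∞)
      (fun q : ℝ × EuclideanSpace ℝ (Fin n) => mollify n F ρ q.1 q.2) (Ioo 0 M ×ˢ univ) := by
    intro M
    have h := contDiffOn_convolution_right_with_param (μ := volume) (n := (⊤ : ℕ∞))
      (f := F) (ContinuousLinearMap.mul ℝ ℝ)
      (g := fun (s : ℝ) (y : EuclideanSpace ℝ (Fin n)) => (s ^ n)⁻¹ * ρ (s⁻¹ • y)) (s := Ioo 0 M)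
      isOpen_Ioo (isCompact_closedBall 0 M) ?_ hF ?_
    · simp only [convolution_eq_swap] at h
      exact h
    · intro s y hs hy
      have : ρ (s⁻¹ • y) = 0 := by
        by_contra h0
        have h1 := hsupp (Function.mem_support.2 h0)
        rw [mem_closedBall_zero_iff, norm_smul, norm_inv, Real.norm_of_nonneg hs.1.le,
          inv_mul_le_iff₀ hs.1, mul_one] at h1
        exact hy (mem_closedBall_zero_iff.2 (h1.trans hs.2.le))
      simp [this]
    · have hinv : ContDiffOn ℝ (⊤ : ℕ∞)
          (fun q : ℝ × EuclideanSpace ℝ (Fin n) => q.1⁻¹) (Ioo 0 M ×ˢ univ) :=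
        contDiff_fst.contDiffOn.inv fun q hq => hq.1.1.ne'
      simp only [← inv_pow]
      exact (hinv.pow n).mul (hρ.comp_contDiffOn (hinv.smul contDiff_snd.contDiffOn))
  intro q hq
  refine ((hbdd (q.1 + 1)).contDiffAt ?_).contDiffWithinAt
  exact (isOpen_Ioo.prod isOpen_univ).mem_nhds ⟨⟨hq.1, by simp⟩, trivial⟩

theorem abs_integral_sub_smul_sub_le (hF : Continuous F) (hρ : Continuous ρ) (hρ0 : ∀ z, 0 ≤ ρ z)
    (hsupp : Function.support ρ ⊆ closedBall 0 1) (hρ1 : ∫ z, ρ z = 1)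
    {x x' : EuclideanSpace ℝ (Fin n)} {s s' C : ℝ}
    (h : ∀ z : EuclideanSpace ℝ (Fin n), ‖z‖ ≤ 1 → |F (x - s • z) - F (x' - s' • z)| ≤ C) :
    |(∫ z, F (x - s • z) * ρ z) - ∫ z, F (x' - s' • z) * ρ z| ≤ C := by
  have hcs : HasCompactSupport ρ := HasCompactSupport.of_support_subset_isCompact
    (isCompact_closedBall 0 1) hsupp
  have hint : ∀ (c : EuclideanSpace ℝ (Fin n)) (t : ℝ),
      Integrable fun z => F (c - t • z) * ρ z := fun c t =>
    ((hF.comp (by fun_prop : Continuous fun z => c - t • z)).mul hρ).integrable_of_hasCompactSupport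
      hcs.mul_left
  rw [← integral_sub (hint _ _) (hint _ _), ← Real.norm_eq_abs]
  calc _ ≤ ∫ z, C * ρ z := by
        refine norm_integral_le_of_norm_le
          ((hρ.integrable_of_hasCompactSupport hcs).const_mul C) (.of_forall fun z => ?_)
        rw [← sub_mul, Real.norm_eq_abs, abs_mul, abs_of_nonneg (hρ0 z)]
        by_cases hz : ρ z = 0
        · simp [hz]
        · exact mul_le_mul_of_nonneg_right
            (h z (mem_closedBall_zero_iff.1 (hsupp hz))) (hρ0 z)
    _ = C := by rw [integral_const_mul, hρ1, mul_one]

end Mollify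

/-- Boundary-preserving smoothing: a Lipschitz `f` on `B(0,r)` with `|d_V f| ≤ 1` and
`|∂_{e_ι} f| ≤ 1` a.e. admits, for `α₁, α₂ ∈ (0,1)`, a smooth approximation `u` agreeing
with `f` on `∂B(0,r)`, uniformly `(α₁α₂/18)r`-close, with `|d_V u| ≤ 1+α₁`,
`|∂_{e_ι} u| ≤ 1+α₁`, and equal to `f ∗ ρ_η` on `B(0,(1−α₂/2)r)` with
`η = α₁α₂ r/(18√(n−j+1))`. -/
theorem stmt19 {n j : ℕ} (hj : j ≤ n) (r : ℝ) (hr : 0 < r)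
    (V : Submodule ℝ (EuclideanSpace ℝ (Fin n))) (hV : Module.finrank ℝ V = j)
    (e : Fin (n - j) → EuclideanSpace ℝ (Fin n))
    (he_mem : ∀ ι, e ι ∈ Vᗮ) (he_on : Orthonormal ℝ e)
    (he_span : Submodule.span ℝ (Set.range e) = Vᗮ)
    (f : EuclideanSpace ℝ (Fin n) → ℝ) (L : NNReal)
    (hf : LipschitzOnWith L f (closedBall 0 r))
    (hderiv : ∀ᵐ x ∂volume, x ∈ ball (0 : EuclideanSpace ℝ (Fin n)) r →
      DifferentiableAt ℝ f x ∧
      (∀ v ∈ V, ‖v‖ ≤ 1 → |fderiv ℝ f x v| ≤ 1) ∧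
      (∀ ι, |fderiv ℝ f x (e ι)| ≤ 1))
    (α₁ α₂ : ℝ) (hα₁ : α₁ ∈ Set.Ioo (0 : ℝ) 1) (hα₂ : α₂ ∈ Set.Ioo (0 : ℝ) 1) :
    ∃ u : EuclideanSpace ℝ (Fin n) → ℝ,
      ContDiffOn ℝ (⊤ : ℕ∞) u (ball 0 r) ∧
      ContinuousOn u (closedBall 0 r) ∧
      (∀ x : EuclideanSpace ℝ (Fin n), ‖x‖ = r → u x = f x) ∧
      (∀ x ∈ closedBall (0 : EuclideanSpace ℝ (Fin n)) r,
        |f x - u x| ≤ α₁ * α₂ / 18 * r) ∧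
      (∀ x ∈ ball (0 : EuclideanSpace ℝ (Fin n)) r,
        (∀ v ∈ V, ‖v‖ ≤ 1 → |fderiv ℝ u x v| ≤ 1 + α₁) ∧
        (∀ ι, |fderiv ℝ u x (e ι)| ≤ 1 + α₁)) ∧
      ∃ ρ : EuclideanSpace ℝ (Fin n) → ℝ,
        ContDiff ℝ (⊤ : ℕ∞) ρ ∧ (∀ z, 0 ≤ ρ z) ∧
        Function.support ρ ⊆ closedBall 0 1 ∧ (∫ z, ρ z) = 1 ∧
        ∀ x ∈ ball (0 : EuclideanSpace ℝ (Fin n)) ((1 - α₂ / 2) * r),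
          u x = mollify n f ρ (α₁ * α₂ * r / (18 * Real.sqrt ((n : ℝ) - (j : ℝ) + 1))) x := by
  obtain ⟨F, hF, hfF⟩ := hf.extend_real
  obtain ⟨hα₁0, hα₁1⟩ := hα₁
  obtain ⟨hα₂0, hα₂1⟩ := hα₂
  have hcard : (n : ℝ) - j = Fintype.card (Fin (n - j)) := by
    rw [Fintype.card_fin, Nat.cast_sub hj]
  rw [hcard]
  set S : ℝ := √(Fintype.card (Fin (n - j)) + 1)
  have hS1 : 1 ≤ S := Real.one_le_sqrt.2 (by simp)
  have hS0 : 0 < S := one_pos.trans_le hS1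
  set η : ℝ := α₁ * α₂ * r / (18 * S) with hη
  have hη0 : 0 < η := by positivity
  have hηS : S * η = α₁ * α₂ / 18 * r := by
    rw [hη]
    field_simp
  set κ : ℝ := 4 * α₁ / (9 * S) with hκ
  have hκ0 : 0 < κ := by positivity
  have hκS : S * κ ≤ α₁ := by
    have : S * κ = 4 / 9 * α₁ := by
      rw [hκ]
      field_simp
    linarith
  have hκ1 : κ < 1 := by nlinarith
  have hηκ : ∀ a : ℝ, η * (4 * |2 * a / (α₂ * r)|) = κ * |a| := fun a => by
    rw [abs_div, abs_mul, abs_of_pos (by positivity : 0 < α₂ * r), abs_two, hη, hκ]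
    field_simp
    ring
  set B : Set (EuclideanSpace ℝ (Fin n)) := ball 0 r with hB
  set R : EuclideanSpace ℝ (Fin n) → ℝ := fun x => η * cutoff (2 * (r - ‖x‖) / (α₂ * r)) with hR
  have hRlip : ∀ x y, |R x - R y| ≤ κ * ‖x - y‖ := by
    intro x y
    have h := cutoff.lipschitzWith.dist_le_mul (2 * (r - ‖x‖) / (α₂ * r))
      (2 * (r - ‖y‖) / (α₂ * r))
    rw [Real.dist_eq, Real.dist_eq, ← sub_div, ← mul_sub, sub_sub_sub_cancel_left] at h
    rw [hR, ← mul_sub, abs_mul, abs_of_pos hη0]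
    refine (mul_le_mul_of_nonneg_left h hη0.le).trans ((hηκ _).trans_le ?_)
    rw [abs_sub_comm]
    exact mul_le_mul_of_nonneg_left (abs_norm_sub_norm_le x y) hκ0.le
  have hRcont : Continuous R := by
    have := (cutoff.contDiff (m := 0)).continuous
    fun_prop
  have hRbdry : ∀ x, ‖x‖ = r → R x = 0 := fun x hx => by simp [hR, hx, cutoff.apply_zero]
  have hRpos : ∀ x ∈ B, 0 < R x := fun x hx => by
    have : 0 < r - ‖x‖ := sub_pos.2 (mem_ball_zero_iff.1 hx)
    exact mul_pos hη0 (cutoff.pos_of_pos (by positivity))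
  have hRlt : ∀ x ∈ B, R x < r - ‖x‖ := fun x hx => by
    have hx' : 0 < r - ‖x‖ := sub_pos.2 (mem_ball_zero_iff.1 hx)
    have h := cutoff.lipschitzWith.dist_le_mul (2 * (r - ‖x‖) / (α₂ * r)) 0
    rw [Real.dist_eq, Real.dist_eq, cutoff.apply_zero, sub_zero, sub_zero] at h
    calc R x ≤ η * (4 * |2 * (r - ‖x‖) / (α₂ * r)|) :=
          mul_le_mul_of_nonneg_left ((le_abs_self _).trans h) hη0.le
      _ = κ * (r - ‖x‖) := by rw [hηκ, abs_of_pos hx']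
      _ < r - ‖x‖ := by nlinarith
  have hRle : ∀ x, R x ≤ η := fun x => mul_le_of_le_one_right hη0.le (cutoff.le_one _)
  have hRconst : ∀ x ∈ ball (0 : EuclideanSpace ℝ (Fin n)) ((1 - α₂ / 2) * r), R x = η := by
    intro x hx
    have hx' := mem_ball_zero_iff.1 hx
    rw [hR]
    simp only
    rw [cutoff.eq_one_of_one_le, mul_one]
    rw [one_le_div (by positivity)]
    linarith
  have hRsmooth : ContDiff ℝ (⊤ : ℕ∞) R := by
    rw [contDiff_iff_contDiffAt]
    intro x
    by_cases hx : x = 0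
    · refine (contDiffAt_const (c := η)).congr_of_eventuallyEq ?_
      filter_upwards [ball_mem_nhds x (show 0 < (1 - α₂ / 2) * r by nlinarith)] with y hy
      exact hRconst y (hx ▸ hy)
    · exact contDiffAt_const.mul (cutoff.contDiff.contDiffAt.comp x
        ((contDiffAt_const.mul (contDiffAt_const.sub (contDiffAt_norm ℝ hx))).div_const _))
  have hmemB : ∀ (x z : EuclideanSpace ℝ (Fin n)) (s : ℝ), 0 ≤ s → s < r - ‖x‖ → ‖z‖ ≤ 1 →
      x - s • z ∈ B := by
    intro x z s hs hsr hz
    rw [hB, mem_ball_zero_iff]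
    refine (norm_sub_le _ _).trans_lt ?_
    rw [norm_smul, Real.norm_of_nonneg hs]
    nlinarith
  have hderivF : ∀ᵐ x ∂volume, x ∈ B → DifferentiableAt ℝ F x ∧
      (∀ v ∈ V, ‖v‖ ≤ 1 → |fderiv ℝ F x v| ≤ 1) ∧ (∀ ι, |fderiv ℝ F x (e ι)| ≤ 1) := by
    filter_upwards [hderiv] with x hx hxB
    have hev : f =ᶠ[nhds x] F := by
      filter_upwards [isOpen_ball.mem_nhds hxB] with y hy
      exact hfF (ball_subset_closedBall hy)
    rw [← hev.fderiv_eq, ← hev.differentiableAt_iff]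
    exact hx hxB
  have hSlip : ∀ y ∈ B, ∀ y' ∈ B, |F y' - F y| ≤ S * ‖y' - y‖ := by
    intro y hy y' hy'
    have h := hF.abs_sub_le_of_ae_abs_fderiv_apply_le volume isOpen_ball (convex_ball 0 r)
      (w := y' - y) (C := S * ‖y' - y‖) ?_ hy (by rwa [add_sub_cancel])
    · simpa using h
    · filter_upwards [hderivF] with x hx hxB
      exact ⟨(hx hxB).1, abs_apply_le_sqrt_mul_norm_of_orthonormal V he_on he_span _
        (hx hxB).2.1 (hx hxB).2.2 _⟩
  let φ : ContDiffBump (0 : EuclideanSpace ℝ (Fin n)) := ⟨1 / 2, 1, by norm_num, by norm_num⟩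
  set ρ := φ.normed volume
  have hρ : ContDiff ℝ (⊤ : ℕ∞) ρ := φ.contDiff_normed
  have hρ0 : ∀ z, 0 ≤ ρ z := φ.nonneg_normed
  have hρsupp : Function.support ρ ⊆ closedBall 0 1 :=
    φ.support_normed_eq.subset.trans ball_subset_closedBall
  have hρ1 : ∫ z, ρ z = 1 := φ.integral_normed
  set u : EuclideanSpace ℝ (Fin n) → ℝ := fun x => ∫ z, F (x - R x • z) * ρ z with hu
  have hcomp : ∀ {x x' : EuclideanSpace ℝ (Fin n)} {s s' C : ℝ}, (∀ z : EuclideanSpace ℝ (Fin n),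
      ‖z‖ ≤ 1 → |F (x - s • z) - F (x' - s' • z)| ≤ C) →
      |(∫ z, F (x - s • z) * ρ z) - ∫ z, F (x' - s' • z) * ρ z| ≤ C := fun h =>
    abs_integral_sub_smul_sub_le hF.continuous hρ.continuous hρ0 hρsupp hρ1 h
  have hF0 : ∀ x, ∫ z, F (x - (0 : ℝ) • z) * ρ z = F x := fun x => by
    simp [integral_const_mul, hρ1]
  have hucont : Continuous u := by
    refine (LipschitzWith.of_dist_le' (K := L * (1 + κ)) fun x y => hcomp fun z hz => ?_).continuous
    refine (hF.dist_le_mul _ _).trans ?_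
    rw [mul_assoc, dist_eq_norm, dist_eq_norm, sub_sub_sub_comm, ← sub_smul]
    refine mul_le_mul_of_nonneg_left ((norm_sub_le _ _).trans ?_) L.2
    rw [norm_smul, Real.norm_eq_abs, add_mul, one_mul]
    exact add_le_add_right ((mul_le_of_le_one_right (abs_nonneg _) hz).trans (hRlip x y)) _
  have husmooth : ContDiffOn ℝ (⊤ : ℕ∞) u B := by
    have h := (contDiffOn_mollify hF.continuous.locallyIntegrable hρ hρsupp).comp
      (hRsmooth.prodMk contDiff_id).contDiffOn (s := B) (fun x hx => ⟨hRpos x hx, trivial⟩)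
    exact h.congr fun x hx => (mollify_eq_integral_sub_smul (hRpos x hx) x).symm
  have hubdry : ∀ x, ‖x‖ = r → u x = f x := fun x hx => by
    rw [hfF (by simp [hx]), hu]
    simp only [hRbdry x hx, hF0]
  have hugrad : ∀ x ∈ B, ∀ w : EuclideanSpace ℝ (Fin n), ‖w‖ ≤ 1 →
      (∀ᵐ y ∂volume, y ∈ B → DifferentiableAt ℝ F y ∧ |fderiv ℝ F y w| ≤ 1) →
      |fderiv ℝ u x w| ≤ 1 + α₁ := by
    intro x hx w hw hae
    have hdiff : DifferentiableAt ℝ u x :=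
      (husmooth.contDiffAt (isOpen_ball.mem_nhds hx)).differentiableAt (by simp)
    have hline : HasDerivAt (fun t : ℝ => x + t • w) w 0 := by
      simpa using ((hasDerivAt_id (0 : ℝ)).smul_const w).const_add x
    have hder : HasDerivAt (fun t : ℝ => u (x + t • w)) (fderiv ℝ u x w) 0 :=
      HasFDerivAt.comp_hasDerivAt_of_eq (0 : ℝ) hdiff.hasFDerivAt hline (by simp)
    have hlim : ContinuousAt (fun t : ℝ => x + t • w) 0 := hline.continuousAt
    have hev1 : ∀ᶠ t : ℝ in nhds 0, x + t • w ∈ B :=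
      hlim.eventually_mem (by simpa using isOpen_ball.mem_nhds hx)
    have hev2 : ∀ᶠ t : ℝ in nhds 0, R (x + t • w) < r - ‖x‖ := by
      have h : ContinuousAt (fun t : ℝ => R (x + t • w)) 0 := by fun_prop
      exact h.eventually_lt continuousAt_const (by simpa using hRlt x hx)
    refine hder.le_of_lip' (by positivity) ?_
    filter_upwards [hev1, hev2] with t ht1 ht2
    simp only [zero_smul, add_zero, sub_zero, Real.norm_eq_abs]
    refine hcomp fun z hz => ?_
    have hm1 := hmemB _ z _ (hRpos _ ht1).le (hRlt _ ht1) hz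
    have hm2 := hmemB x z _ (hRpos _ ht1).le ht2 hz
    have hm3 := hmemB x z _ (hRpos _ hx).le (hRlt _ hx) hz
    rw [add_sub_right_comm] at hm1 ⊢
    have h1 : |F (x - R (x + t • w) • z + t • w) - F (x - R (x + t • w) • z)| ≤ |t| := by
      refine hF.abs_sub_le_of_ae_abs_fderiv_apply_le volume isOpen_ball (convex_ball 0 r)
        ?_ hm2 hm1
      filter_upwards [hae] with y hy hyB
      refine ⟨(hy hyB).1, ?_⟩
      rw [map_smul, smul_eq_mul, abs_mul]
      exact mul_le_of_le_one_right (abs_nonneg _) (hy hyB).2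
    have h2 : |F (x - R (x + t • w) • z) - F (x - R x • z)| ≤ α₁ * |t| := by
      refine (hSlip _ hm3 _ hm2).trans ?_
      rw [sub_sub_sub_cancel_left, ← sub_smul, norm_smul, Real.norm_eq_abs]
      have h3 := hRlip x (x + t • w)
      rw [sub_add_cancel_left, norm_neg, norm_smul, Real.norm_eq_abs] at h3
      calc S * (|R x - R (x + t • w)| * ‖z‖) ≤ S * (κ * (|t| * 1) * 1) := by
            gcongr
            exact h3.trans (by gcongr)
        _ = S * κ * |t| := by ring
        _ ≤ α₁ * |t| := by gcongr
    calc _ ≤ _ := abs_sub_le _ (F (x - R (x + t • w) • z)) _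
      _ ≤ |t| + α₁ * |t| := add_le_add h1 h2
      _ = (1 + α₁) * |t| := by ring
  refine ⟨u, husmooth, hucont.continuousOn, hubdry, ?_, ?_, ρ, hρ, hρ0, hρsupp, hρ1, ?_⟩
  · intro x hx
    rcases (mem_closedBall_zero_iff.1 hx).eq_or_lt with hxr | hxr
    · rw [hubdry x hxr, sub_self, abs_zero]
      positivity
    · have hxB : x ∈ B := mem_ball_zero_iff.2 hxr
      rw [hfF hx, ← hF0 x, ← hηS]
      refine hcomp fun z hz => ?_
      rw [zero_smul, sub_zero]
      refine (hSlip _ (hmemB x z _ (hRpos x hxB).le (hRlt x hxB) hz) _ hxB).trans ?_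
      rw [sub_sub_cancel, norm_smul, Real.norm_of_nonneg (hRpos x hxB).le]
      gcongr
      exact (mul_le_of_le_one_right (hRpos x hxB).le hz).trans (hRle x)
  · intro x hx
    refine ⟨fun v hv hv1 => hugrad x hx v hv1 ?_, fun ι => hugrad x hx _ (he_on.1 ι).le ?_⟩
    · filter_upwards [hderivF] with y hy hyB
      exact ⟨(hy hyB).1, (hy hyB).2.1 v hv hv1⟩
    · filter_upwards [hderivF] with y hy hyB
      exact ⟨(hy hyB).1, (hy hyB).2.2 ι⟩
  · intro x hx
    have hxB : x ∈ B := ball_subset_ball (by nlinarith) hx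
    rw [mollify_eq_integral_sub_smul hη0, hu]
    simp only
    refine integral_congr_ae (.of_forall fun z => ?_)
    by_cases hz : ρ z = 0
    · simp [hz]
    · have hmem := hmemB x z _ (hRpos x hxB).le (hRlt x hxB)
        (mem_closedBall_zero_iff.1 (hρsupp hz))
      have hval := hfF (ball_subset_closedBall hmem)
      rw [hRconst x hx] at hval
      simp only [hRconst x hx, hval]
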